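/- A set F ⊂ M^p is relatively compact for the OT_p metric if and only if the family {μ^p : μ ∈ F} is tight (for every ε > 0 there is a compact K ⊂ Ω with μ^p(Ω∖K) ≤ ε for all μ ∈ F) and sup_{μ∈F} Pers_p(μ) < ∞. -/

import Mathlib

noncomputable section

open MeasureTheory Metric Set Filter Topology ENNReal
open scoped Classical

/-- The plane with the Euclidean distance. -/
abbrev Pt : Type := EuclideanSpace ℝ (Fin 2)

/-- Build a point of the plane from coordinates. -/
def mk2 (a b : ℝ) : Pt := (WithLp.equiv 2 (Fin 2 → ℝ)).symm ![a, b]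

/-- The open upper half-plane Ω = {(t₁,t₂) : t₂ > t₁}. -/
def UHP : Set Pt := {x | x 0 < x 1}

/-- The diagonal ∂Ω = {(t,t)}. -/
def Diag : Set Pt := {x | x 0 = x 1}

/-- Ω̄ = Ω ∪ ∂Ω. -/
def UHPbar : Set Pt := UHP ∪ Diag

/-- Distance from a point to the diagonal. -/
def persDist (x : Pt) : ℝ := infDist x Diag

/-- p-th total persistence Pers_p(μ) = ∫_Ω d(x,∂Ω)^p dμ(x). -/
def Pers (p : ℝ) (μ : Measure Pt) : ℝ≥0∞ :=
  ∫⁻ x in UHP, ENNReal.ofReal (persDist x ^ p) ∂μ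

/-- μ ∈ M^p : a measure supported on Ω with finite p-th persistence. -/
def MemMp (p : ℝ) (μ : Measure Pt) : Prop := μ UHPᶜ = 0 ∧ Pers p μ < ⊤

/-- Admissible partial transport plans between μ and ν: measures on Ω̄ × Ω̄ whose
marginals restricted to Ω are μ and ν. -/
def Adm (μ ν : Measure Pt) : Set (Measure (Pt × Pt)) :=
  {π | π ((UHPbar ×ˢ UHPbar)ᶜ) = 0 ∧
    (∀ A : Set Pt, MeasurableSet A → A ⊆ UHP → π (A ×ˢ univ) = μ A) ∧
    (∀ B : Set Pt, MeasurableSet B → B ⊆ UHP → π (univ ×ˢ B) = ν B)}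

/-- Cost C_p(π) = ∬ d(x,y)^p dπ(x,y). -/
def Cost (p : ℝ) (π : Measure (Pt × Pt)) : ℝ≥0∞ :=
  ∫⁻ z, ENNReal.ofReal (dist z.1 z.2 ^ p) ∂π

/-- OT_p(μ,ν)^p, as an extended real. -/
def OTe (p : ℝ) (μ ν : Measure Pt) : ℝ≥0∞ := ⨅ π ∈ Adm μ ν, Cost p π

/-- The optimal partial transport distance OT_p(μ,ν). -/
def OT (p : ℝ) (μ ν : Measure Pt) : ℝ := (OTe p μ ν ^ (1 / p)).toReal

/-- Optimal plans. -/
def OptSet (p : ℝ) (μ ν : Measure Pt) : Set (Measure (Pt × Pt)) :=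
  {π | π ∈ Adm μ ν ∧ Cost p π = OTe p μ ν}

/-- Vague convergence of measures on Ω: convergence of integrals of continuous
functions compactly supported in Ω. -/
def VagueTendsto (μs : ℕ → Measure Pt) (μ : Measure Pt) : Prop :=
  ∀ f : Pt → ℝ, Continuous f → HasCompactSupport f → tsupport f ⊆ UHP →
    Tendsto (fun n => ∫ x, f x ∂(μs n)) atTop (𝓝 (∫ x, f x ∂μ))

/-- E_Ω = (Ω̄ × Ω̄) \ (∂Ω × ∂Ω). -/
def EOm : Set (Pt × Pt) := (UHPbar ×ˢ UHPbar) \ (Diag ×ˢ Diag)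

/-- Vague convergence of plans on E_Ω. -/
def VaguePlanTendsto (πs : ℕ → Measure (Pt × Pt)) (π : Measure (Pt × Pt)) : Prop :=
  ∀ f : Pt × Pt → ℝ, Continuous f → HasCompactSupport f → tsupport f ⊆ EOm →
    Tendsto (fun n => ∫ z, f z ∂(πs n)) atTop (𝓝 (∫ z, f z ∂π))

/-- A persistence diagram: an ℕ-valued point measure Σ_{x ∈ X} n_x δ_x with
X ⊆ Ω locally finite in Ω. -/
def IsDiagram (μ : Measure Pt) : Prop :=
  ∃ (X : Set Pt) (n : Pt → ℕ), X ⊆ UHP ∧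
    (∀ x ∈ UHP, ∃ U ∈ 𝓝 x, (X ∩ U).Finite) ∧
    μ = Measure.sum (fun x : X => (n x.1 : ℝ≥0∞) • Measure.dirac (x.1 : Pt))

/-- Support of a measure on Pt × Pt. -/
def msupp (π : Measure (Pt × Pt)) : Set (Pt × Pt) := {z | ∀ U ∈ 𝓝 z, π U ≠ 0}

/-- Support of a measure on Pt. -/
def suppM (μ : Measure Pt) : Set Pt := {x | ∀ U ∈ 𝓝 x, μ U ≠ 0}

/-- Bottleneck cost of a plan: sup of d(x,y) over the support. -/
def CostInf (π : Measure (Pt × Pt)) : ℝ≥0∞ :=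
  ⨆ z ∈ msupp π, ENNReal.ofReal (dist z.1 z.2)

/-- The bottleneck (∞) optimal partial transport distance, as extended real. -/
def OTinfE (μ ν : Measure Pt) : ℝ≥0∞ := ⨅ π ∈ Adm μ ν, CostInf π

/-- μ ∈ M^∞ : support at bounded distance from the diagonal. -/
def MemMinf (μ : Measure Pt) : Prop :=
  μ UHPᶜ = 0 ∧ ∃ C : ℝ, ∀ x ∈ suppM μ, persDist x ≤ C

/-- A partial matching between two indexed families: a bijection between
subsets of the index sets; unmatched points are sent to the diagonal. -/
structure Matching (ι κ : Type*) where
  I : Set ι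
  J : Set κ
  e : I ≃ J

/-- Cost of a partial matching for d_p (as the p-th power, extended real). -/
def mCost (p : ℝ) {ι κ : Type*} (x : ι → Pt) (y : κ → Pt) (m : Matching ι κ) : ℝ≥0∞ :=
  (∑' i : m.I, ENNReal.ofReal (dist (x i.1) (y (m.e i).1) ^ p))
  + (∑' i : ↥(m.Iᶜ), ENNReal.ofReal (persDist (x i.1) ^ p))
  + (∑' j : ↥(m.Jᶜ), ENNReal.ofReal (persDist (y j.1) ^ p))

/-- Bottleneck cost of a partial matching. -/
def mCostInf {ι κ : Type*} (x : ι → Pt) (y : κ → Pt) (m : Matching ι κ) : ℝ≥0∞ :=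
  (⨆ i : m.I, ENNReal.ofReal (dist (x i.1) (y (m.e i).1)))
  ⊔ (⨆ i : ↥(m.Iᶜ), ENNReal.ofReal (persDist (x i.1)))
  ⊔ (⨆ j : ↥(m.Jᶜ), ENNReal.ofReal (persDist (y j.1)))

/-- The point measure associated to an indexed family of points. -/
def famMeasure {ι : Type*} (x : ι → Pt) : Measure Pt :=
  Measure.sum (fun i => Measure.dirac (x i))

/-- The weighted measure μ^p, with density d(x,∂Ω)^p with respect to μ. -/
def wgt (p : ℝ) (μ : Measure Pt) : Measure Pt :=
  μ.withDensity (fun x => ENNReal.ofReal (persDist x ^ p))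

/-- The quotient space Ω̃ = Ω ⊔ {∂Ω}. -/
def Qt : Type := Option ↥UHP

/-- The quotient metric ρ on Ω̃. -/
def ρQ : Qt → Qt → ℝ
  | some x, some y => min (dist (x : Pt) (y : Pt)) (persDist x + persDist y)
  | some x, none => persDist x
  | none, some y => persDist y
  | none, none => 0

/-- The quotient metric ρ viewed on the plane, all diagonal points being
identified. -/
def ρP (x y : Pt) : ℝ :=
  if x ∈ Diag then (if y ∈ Diag then 0 else persDist y)
  else if y ∈ Diag then persDist x
  else min (dist x y) (persDist x + persDist y)

/-- Couplings with full (equal-mass) marginals. -/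
def Coup (μ ν : Measure Pt) : Set (Measure (Pt × Pt)) :=
  {π | π.map Prod.fst = μ ∧ π.map Prod.snd = ν}

/-- The p-Wasserstein distance (to the p) for the quotient metric ρ. -/
def WpE (p : ℝ) (μ ν : Measure Pt) : ℝ≥0∞ :=
  ⨅ π ∈ Coup μ ν, ∫⁻ z, ENNReal.ofReal (ρP z.1 z.2 ^ p) ∂π


lemma cont_coord (i : Fin 2) : Continuous (fun x : Pt => x i) := by fun_prop

lemma isOpen_UHP : IsOpen UHP := isOpen_lt (cont_coord 0) (cont_coord 1)

lemma isClosed_Diag : IsClosed Diag := isClosed_eq (cont_coord 0) (cont_coord 1)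

lemma UHPbar_eq : UHPbar = {x : Pt | x 0 ≤ x 1} := by
  ext x
  simp only [UHPbar, UHP, Diag, mem_union, mem_ofPred_eq]
  exact le_iff_lt_or_eq.symm

lemma isClosed_UHPbar : IsClosed UHPbar := by
  rw [UHPbar_eq]; exact isClosed_le (cont_coord 0) (cont_coord 1)

lemma zero_mem_Diag : (0 : Pt) ∈ Diag := by simp [Diag]

lemma cont_persDist : Continuous persDist := continuous_infDist_pt _

lemma persDist_nonneg (x : Pt) : 0 ≤ persDist x := infDist_nonneg

lemma persDist_Diag {x : Pt} (hx : x ∈ Diag) : persDist x = 0 := infDist_zero_of_mem hx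

lemma persDist_pos {x : Pt} (hx : x ∈ UHP) : 0 < persDist x := by
  refine (isClosed_Diag.notMem_iff_infDist_pos ⟨0, zero_mem_Diag⟩).1 ?_
  intro h
  simp only [UHP, Diag, mem_ofPred_eq] at hx h
  exact absurd h hx.ne

lemma persDist_le (x y : Pt) : persDist x ≤ dist x y + persDist y := by
  have := infDist_le_infDist_add_dist (s := Diag) (x := x) (y := y)
  unfold persDist; linarith

lemma meas_w (p : ℝ) : Measurable (fun x : Pt => ENNReal.ofReal (persDist x ^ p)) :=
  ((cont_persDist.measurable.pow_const p)).ennreal_ofReal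

lemma wgt_apply (p : ℝ) (μ : Measure Pt) {A : Set Pt} (hA : MeasurableSet A) :
    wgt p μ A = ∫⁻ x in A, ENNReal.ofReal (persDist x ^ p) ∂μ :=
  withDensity_apply _ hA

lemma wgt_UHP (p : ℝ) (μ : Measure Pt) : wgt p μ UHP = Pers p μ :=
  wgt_apply p μ isOpen_UHP.measurableSet

lemma wgt_compl (p : ℝ) (μ : Measure Pt) (h : μ UHPᶜ = 0) : wgt p μ UHPᶜ = 0 :=
  withDensity_absolutelyContinuous _ _ h

lemma wgt_univ (p : ℝ) (μ : Measure Pt) (h : μ UHPᶜ = 0) : wgt p μ univ = Pers p μ := by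
  rw [← measure_add_measure_compl isOpen_UHP.measurableSet, wgt_compl p μ h, wgt_UHP, add_zero]

lemma exists_bounds {K : Set Pt} (hK : IsCompact K) (hKU : K ⊆ UHP) :
    ∃ d D : ℝ, 0 < d ∧ 0 < D ∧ ∀ x ∈ K, d ≤ persDist x ∧ persDist x ≤ D := by
  rcases K.eq_empty_or_nonempty with rfl | hne
  · exact ⟨1, 1, one_pos, one_pos, by simp⟩
  · obtain ⟨a, ha, hmin⟩ := hK.exists_isMinOn hne cont_persDist.continuousOn
    obtain ⟨b, hb, hmax⟩ := hK.exists_isMaxOn hne cont_persDist.continuousOn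
    exact ⟨persDist a, persDist b, persDist_pos (hKU ha), persDist_pos (hKU hb),
      fun x hx => ⟨hmin hx, hmax hx⟩⟩

/-- The marginals of a plan. -/
lemma marg_fst {μ ν : Measure Pt} {π : Measure (Pt × Pt)} (hπ : π ∈ Adm μ ν)
    {f : Pt → ℝ≥0∞} (hf : Measurable f) {A : Set Pt} (hA : MeasurableSet A) (hAU : A ⊆ UHP) :
    ∫⁻ x in A, f x ∂μ = ∫⁻ z in Prod.fst ⁻¹' A, f z.1 ∂π := by
  have : μ.restrict A = (π.restrict (Prod.fst ⁻¹' A)).map Prod.fst := by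
    ext B hB
    rw [Measure.restrict_apply hB, Measure.map_apply measurable_fst hB,
      Measure.restrict_apply (measurable_fst hB),
      ← hπ.2.1 (B ∩ A) (hB.inter hA) (inter_subset_right.trans hAU)]
    congr 1; ext z; simp
  rw [this, lintegral_map hf measurable_fst]

lemma marg_snd {μ ν : Measure Pt} {π : Measure (Pt × Pt)} (hπ : π ∈ Adm μ ν)
    {f : Pt → ℝ≥0∞} (hf : Measurable f) {A : Set Pt} (hA : MeasurableSet A) (hAU : A ⊆ UHP) :
    ∫⁻ x in A, f x ∂ν = ∫⁻ z in Prod.snd ⁻¹' A, f z.2 ∂π := by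
  have : ν.restrict A = (π.restrict (Prod.snd ⁻¹' A)).map Prod.snd := by
    ext B hB
    rw [Measure.restrict_apply hB, Measure.map_apply measurable_snd hB,
      Measure.restrict_apply (measurable_snd hB),
      ← hπ.2.2 (B ∩ A) (hB.inter hA) (inter_subset_right.trans hAU)]
    congr 1; ext z; simp
  rw [this, lintegral_map hf measurable_snd]

lemma key_ineq (p : ℝ) (hp : 1 ≤ p) (K : Set Pt) (hK : IsCompact K) (hKU : K ⊆ UHP)
    (r : ℝ) (hr : 0 < r) :
    ∃ C : ℝ, 0 ≤ C ∧ ∀ μ ν : Measure Pt,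
      wgt p μ (UHP \ cthickening r K) ≤
        ENNReal.ofReal C * OTe p μ ν + ENNReal.ofReal (2 ^ p) * wgt p ν (UHP \ K) := by
  obtain ⟨d, D, hd, hD, hdD⟩ := exists_bounds hK hKU
  have hp0 : 0 ≤ p := by linarith
  set C : ℝ := 2 ^ p + (1 + D / r) ^ p with hC
  have hDr : 0 < D / r := by positivity
  have hC2 : (2:ℝ) ^ p ≤ C := by
    have : 0 ≤ (1 + D / r) ^ p := by positivity
    linarith
  have hC3 : (1 + D / r) ^ p ≤ C := by
    have : 0 ≤ (2:ℝ) ^ p := by positivity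
    linarith
  have hC1 : 1 ≤ C := le_trans (Real.one_le_rpow (by norm_num) hp0) hC2
  have hC0 : 0 ≤ C := by linarith
  -- pointwise inequality
  have pt1 : ∀ x ∉ cthickening r K, ∀ y ∈ UHPbar, y ∉ UHP \ K →
      persDist x ^ p ≤ C * dist x y ^ p := by
    intro x hx y hy hyK
    by_cases hyU : y ∈ UHP
    · have hyK' : y ∈ K := by by_contra h; exact hyK ⟨hyU, h⟩
      have h1 : r ≤ dist x y := by
        by_contra h
        exact hx (mem_cthickening_of_dist_le x y r K hyK' (le_of_not_ge h))
      have h2 : persDist x ≤ (1 + D / r) * dist x y := by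
        have := persDist_le x y
        have h3 := (hdD y hyK').2
        have h4 : D ≤ D / r * dist x y := by
          rw [div_mul_eq_mul_div, le_div_iff₀ hr]
          exact mul_le_mul_of_nonneg_left h1 hD.le
        linarith
      calc persDist x ^ p ≤ ((1 + D / r) * dist x y) ^ p :=
            Real.rpow_le_rpow (persDist_nonneg x) h2 hp0
        _ = (1 + D / r) ^ p * dist x y ^ p := Real.mul_rpow (by positivity) dist_nonneg
        _ ≤ _ := by gcongr
    · have hyD : y ∈ Diag := by
        rcases hy with h | h
        · exact absurd h hyU
        · exact h
      have := persDist_le x y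
      rw [persDist_Diag hyD, add_zero] at this
      calc persDist x ^ p ≤ dist x y ^ p := Real.rpow_le_rpow (persDist_nonneg x) this hp0
        _ = 1 * dist x y ^ p := (one_mul _).symm
        _ ≤ _ := by gcongr
  have pt2 : ∀ x y, persDist x ^ p ≤ C * dist x y ^ p + 2 ^ p * persDist y ^ p := by
    intro x y
    have h0 := persDist_le x y
    have h1 : persDist x ≤ 2 * max (dist x y) (persDist y) := by
      have := le_max_left (dist x y) (persDist y)
      have := le_max_right (dist x y) (persDist y)
      linarith
    have a0 : 0 ≤ dist x y ^ p := Real.rpow_nonneg dist_nonneg p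
    have b0 : 0 ≤ persDist y ^ p := Real.rpow_nonneg (persDist_nonneg y) p
    calc persDist x ^ p ≤ (2 * max (dist x y) (persDist y)) ^ p :=
            Real.rpow_le_rpow (persDist_nonneg x) h1 hp0
      _ = 2 ^ p * (max (dist x y) (persDist y)) ^ p :=
          Real.mul_rpow (by norm_num) (le_max_of_le_left dist_nonneg)
      _ ≤ 2 ^ p * (dist x y ^ p + persDist y ^ p) := by
          gcongr
          rcases max_choice (dist x y) (persDist y) with h | h <;> rw [h] <;> linarith
      _ ≤ _ := by rw [mul_add]; gcongr
  refine ⟨C, hC0, fun μ ν => ?_⟩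
  have hAm : MeasurableSet (UHP \ cthickening r K) :=
    isOpen_UHP.measurableSet.diff isClosed_cthickening.measurableSet
  have hBm : MeasurableSet (UHP \ K) :=
    isOpen_UHP.measurableSet.diff hK.isClosed.measurableSet
  have main : ∀ π ∈ Adm μ ν, wgt p μ (UHP \ cthickening r K) ≤
      ENNReal.ofReal C * Cost p π + ENNReal.ofReal (2 ^ p) * wgt p ν (UHP \ K) := by
    intro π hπ
    rw [wgt_apply _ _ hAm, wgt_apply _ _ hBm, marg_fst hπ (meas_w p) hAm sdiff_subset,
      marg_snd hπ (meas_w p) hBm sdiff_subset, Cost]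
    have hcm : Measurable (fun z : Pt × Pt => ENNReal.ofReal (dist z.1 z.2 ^ p)) :=
      ((measurable_fst.dist measurable_snd).pow_const p).ennreal_ofReal
    have hsm : Measurable ((Prod.snd ⁻¹' (UHP \ K)).indicator
        (fun z : Pt × Pt => ENNReal.ofReal (persDist z.2 ^ p))) :=
      ((meas_w p).comp measurable_snd).indicator (measurable_snd hBm)
    rw [← lintegral_indicator (measurable_fst hAm), ← lintegral_indicator (measurable_snd hBm),
      ← lintegral_const_mul _ hcm, ← lintegral_const_mul _ hsm,
      ← lintegral_add_left (hcm.const_mul _)]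
    refine lintegral_mono_ae ?_
    have hae : ∀ᵐ z ∂π, z ∈ UHPbar ×ˢ UHPbar := hπ.1
    filter_upwards [hae] with z hz
    by_cases hzA : z.1 ∈ UHP \ cthickening r K
    · rw [indicator_of_mem (show z ∈ Prod.fst ⁻¹' (UHP \ cthickening r K) from hzA)]
      by_cases hzB : z.2 ∈ UHP \ K
      · rw [indicator_of_mem (show z ∈ Prod.snd ⁻¹' (UHP \ K) from hzB),
          ← ENNReal.ofReal_mul hC0, ← ENNReal.ofReal_mul (by positivity),
          ← ENNReal.ofReal_add]
        · exact ENNReal.ofReal_le_ofReal (pt2 _ _)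
        · exact mul_nonneg hC0 (Real.rpow_nonneg dist_nonneg p)
        · exact mul_nonneg (by positivity) (Real.rpow_nonneg (persDist_nonneg _) p)
      · rw [← ENNReal.ofReal_mul hC0]
        exact le_add_right (ENNReal.ofReal_le_ofReal (pt1 _ hzA.2 _ hz.2 hzB))
    · rw [indicator_of_notMem (show z ∉ Prod.fst ⁻¹' (UHP \ cthickening r K) from hzA)]
      exact zero_le
  rw [OTe]
  simp only [ENNReal.mul_iInf_of_ne (ENNReal.ofReal_pos.2 (by linarith : 0 < C)).ne'
    ENNReal.ofReal_ne_top, ENNReal.iInf_add]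
  exact le_iInf₂ main

lemma boundedness (p : ℝ) (hp : 1 ≤ p) (F : Set (Measure Pt))
    (H : ∀ μs : ℕ → Measure Pt, (∀ n, μs n ∈ F) →
        ∃ μ, MemMp p μ ∧ ∃ φ : ℕ → ℕ, StrictMono φ ∧
          Tendsto (fun n => OTe p (μs (φ n)) μ) atTop (𝓝 0)) :
    (⨆ μ ∈ F, Pers p μ) < ⊤ := by
  by_contra hcon
  have hcon' : (⨆ μ ∈ F, Pers p μ) = ⊤ := not_lt_top_iff.1 hcon
  have hex : ∀ n : ℕ, ∃ μ ∈ F, (n : ℝ≥0∞) < Pers p μ := by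
    intro n
    have : (n : ℝ≥0∞) < ⨆ μ ∈ F, Pers p μ := by rw [hcon']; exact ENNReal.natCast_lt_top n
    simpa only [lt_iSup_iff, exists_prop] using this
  choose μs hμF hμn using hex
  obtain ⟨μ, hμ, φ, hφ, hlim⟩ := H μs hμF
  obtain ⟨C, hC0, hC⟩ := key_ineq p hp ∅ isCompact_empty (empty_subset _) 1 one_pos
  simp only [cthickening_empty, sdiff_empty, wgt_UHP] at hC
  have hB : ENNReal.ofReal C * 1 + ENNReal.ofReal (2 ^ p) * Pers p μ < ⊤ := by
    have := ENNReal.mul_lt_top (ENNReal.ofReal_lt_top (r := 2 ^ p)) hμ.2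
    exact ENNReal.add_lt_top.2 ⟨by simp, this⟩
  obtain ⟨N, hN⟩ := ENNReal.exists_nat_gt hB.ne
  have h1 : ∀ᶠ n in atTop, OTe p (μs (φ n)) μ ≤ 1 :=
    (hlim.eventually (gt_mem_nhds one_pos)).mono fun _ h => le_of_lt h
  obtain ⟨n, hn1, hnN⟩ := (h1.and (eventually_ge_atTop N)).exists
  have h2 : (N : ℝ≥0∞) ≤ Pers p (μs (φ n)) :=
    le_trans (by exact_mod_cast hnN.trans (hφ.id_le n)) (hμn (φ n)).le
  have h3 := hC (μs (φ n)) μ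
  have h4 : ENNReal.ofReal C * OTe p (μs (φ n)) μ ≤ ENNReal.ofReal C * 1 := by gcongr
  exact absurd (lt_of_le_of_lt (h2.trans (h3.trans (add_le_add_left h4 _))) hN) (lt_irrefl _)

/-- An exhaustion of `UHP` by compact sets. -/
lemma exhaustion : ∃ K : ℕ → Set Pt, (∀ n, IsCompact (K n)) ∧ (∀ n, K n ⊆ UHP) ∧
    ∀ L, IsCompact L → L ⊆ UHP → ∃ N, ∀ n ≥ N, L ⊆ K n := by
  refine ⟨fun n => (closedBall 0 n ∩ UHPbar) ∩ {x | 1 / ((n : ℝ) + 1) ≤ persDist x}, ?_, ?_, ?_⟩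
  · intro n
    exact ((isCompact_closedBall _ _).inter_right isClosed_UHPbar).inter_right
      (isClosed_le continuous_const cont_persDist)
  · rintro n x ⟨⟨-, hx | hx⟩, hx2⟩
    · exact hx
    · simp only [mem_ofPred_eq, persDist_Diag hx] at hx2
      have : 0 < 1 / ((n : ℝ) + 1) := by positivity
      linarith
  · intro L hL hLU
    obtain ⟨d, D, hd, -, hdD⟩ := exists_bounds hL hLU
    obtain ⟨R, hR⟩ := hL.isBounded.subset_closedBall (0 : Pt)
    obtain ⟨N1, hN1⟩ := exists_nat_gt R
    obtain ⟨N2, hN2⟩ := exists_nat_one_div_lt hd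
    refine ⟨max N1 N2, fun n hn x hx => ⟨⟨?_, Or.inl (hLU hx)⟩, ?_⟩⟩
    · have : (N1 : ℝ) ≤ n := by exact_mod_cast (le_max_left _ _).trans hn
      exact closedBall_subset_closedBall (by linarith) (hR hx)
    · have : (N2 : ℝ) ≤ n := by exact_mod_cast (le_max_right _ _).trans hn
      refine le_trans (le_trans ?_ hN2.le) (hdD x hx).1
      exact one_div_le_one_div_of_le (by positivity) (by linarith)

lemma inner_reg (p : ℝ) (μ : Measure Pt) (hμ : MemMp p μ) {ε : ℝ≥0∞} (hε : ε ≠ 0) :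
    ∃ K, IsCompact K ∧ K ⊆ UHP ∧ wgt p μ (UHP \ K) < ε := by
  have : IsFiniteMeasure (wgt p μ) := ⟨by rw [wgt_univ p μ hμ.1]; exact hμ.2⟩
  obtain ⟨K, h1, h2, h3⟩ := isOpen_UHP.measurableSet.exists_isCompact_sdiff_lt
    (measure_ne_top (wgt p μ) _) hε
  exact ⟨K, h2, h1, h3⟩

lemma tightness (p : ℝ) (hp : 1 ≤ p) (F : Set (Measure Pt))
    (H : ∀ μs : ℕ → Measure Pt, (∀ n, μs n ∈ F) →
        ∃ μ, MemMp p μ ∧ ∃ φ : ℕ → ℕ, StrictMono φ ∧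
          Tendsto (fun n => OTe p (μs (φ n)) μ) atTop (𝓝 0)) (ε : ℝ) (hε : 0 < ε) :
    ∃ K : Set Pt, IsCompact K ∧ K ⊆ UHP ∧ ∀ μ ∈ F, wgt p μ (UHP \ K) ≤ ENNReal.ofReal ε := by
  by_contra hcon
  push Not at hcon
  obtain ⟨K, hKc, hKU, hKL⟩ := exhaustion
  choose μs hμF hμn using fun n => hcon (K n) (hKc n) (hKU n)
  obtain ⟨μ, hμ, φ, hφ, hlim⟩ := H μs hμF
  have hc : 0 < (2:ℝ) ^ p := by positivity
  obtain ⟨L, hLc, hLU, hL⟩ := inner_reg p μ hμ (ε := ENNReal.ofReal (ε / 2 / 2 ^ p))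
    (ENNReal.ofReal_pos.2 (by positivity)).ne'
  obtain ⟨r, hr, hrU⟩ := hLc.exists_cthickening_subset_open isOpen_UHP hLU
  obtain ⟨C, hC0, hC⟩ := key_ineq p hp L hLc hLU r hr
  obtain ⟨N, hN⟩ := hKL _ hLc.cthickening hrU
  have h1 : Tendsto (fun n => ENNReal.ofReal C * OTe p (μs (φ n)) μ) atTop (𝓝 0) := by
    simpa using ENNReal.Tendsto.const_mul hlim (Or.inr ENNReal.ofReal_ne_top)
  have h2 : ∀ᶠ n in atTop, ENNReal.ofReal C * OTe p (μs (φ n)) μ < ENNReal.ofReal (ε / 2) :=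
    h1.eventually (gt_mem_nhds (ENNReal.ofReal_pos.2 (by positivity)))
  obtain ⟨n, hn1, hnN⟩ := (h2.and (eventually_ge_atTop N)).exists
  have h3 : wgt p (μs (φ n)) (UHP \ K (φ n)) ≤ wgt p (μs (φ n)) (UHP \ cthickening r L) :=
    measure_mono (sdiff_subset_sdiff_right (hN _ (hnN.trans (hφ.id_le n))))
  have h4 : ENNReal.ofReal (2 ^ p) * wgt p μ (UHP \ L) ≤ ENNReal.ofReal (ε / 2) := by
    calc _ ≤ ENNReal.ofReal (2 ^ p) * ENNReal.ofReal (ε / 2 / 2 ^ p) := by gcongr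
      _ = _ := by
        rw [← ENNReal.ofReal_mul hc.le]; congr 1; field_simp
  have h5 : wgt p (μs (φ n)) (UHP \ K (φ n)) ≤ ENNReal.ofReal ε := by
    refine (h3.trans (hC _ μ)).trans ((add_le_add hn1.le h4).trans ?_)
    rw [← ENNReal.ofReal_add (by positivity) (by positivity)]
    simp
  exact absurd (hμn (φ n)) (not_lt.2 h5)

/-- Orthogonal projection to the diagonal. -/
def projD (x : Pt) : Pt := mk2 ((x 0 + x 1) / 2) ((x 0 + x 1) / 2)

lemma projD_zero (x : Pt) : projD x 0 = (x 0 + x 1) / 2 := by simp [projD, mk2]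

lemma projD_one (x : Pt) : projD x 1 = (x 0 + x 1) / 2 := by simp [projD, mk2]

lemma projD_mem (x : Pt) : projD x ∈ Diag := by
  simp [Diag, projD_zero, projD_one]

lemma cont_projD : Continuous projD := by
  unfold projD mk2
  simp only [WithLp.equiv_symm_apply]
  fun_prop

lemma dist_projD (x : Pt) : dist x (projD x) = persDist x := by
  apply le_antisymm
  · refine (le_infDist ⟨0, zero_mem_Diag⟩).2 ?_
    intro y hy
    rw [EuclideanSpace.dist_eq, EuclideanSpace.dist_eq]
    apply Real.sqrt_le_sqrt
    simp only [Fin.sum_univ_two, Real.dist_eq, sq_abs, projD_zero, projD_one]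
    have : y 0 = y 1 := hy
    rw [this]
    nlinarith [sq_nonneg (x 0 + x 1 - 2 * y 1)]
  · exact infDist_le_dist_of_mem (projD_mem x)

lemma Diag_disj {x : Pt} (hx : x ∈ Diag) : x ∉ UHP := by
  intro h
  simp only [UHP, Diag, mem_ofPred_eq] at hx h
  exact absurd hx h.ne

lemma OTe_add (p : ℝ) (μ₁ μ₂ ν₁ ν₂ : Measure Pt) :
    OTe p (μ₁ + μ₂) (ν₁ + ν₂) ≤ OTe p μ₁ ν₁ + OTe p μ₂ ν₂ := by
  have h : ∀ π₁ ∈ Adm μ₁ ν₁, ∀ π₂ ∈ Adm μ₂ ν₂,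
      OTe p (μ₁ + μ₂) (ν₁ + ν₂) ≤ Cost p π₁ + Cost p π₂ := by
    intro π₁ h₁ π₂ h₂
    have hm : π₁ + π₂ ∈ Adm (μ₁ + μ₂) (ν₁ + ν₂) := by
      refine ⟨?_, ?_, ?_⟩
      · rw [Measure.add_apply, h₁.1, h₂.1, add_zero]
      · intro A hA hAU
        rw [Measure.add_apply, h₁.2.1 A hA hAU, h₂.2.1 A hA hAU, Measure.add_apply]
      · intro A hA hAU
        rw [Measure.add_apply, h₁.2.2 A hA hAU, h₂.2.2 A hA hAU, Measure.add_apply]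
    refine (iInf₂_le _ hm).trans ?_
    rw [Cost, lintegral_add_measure]; rfl
  conv_rhs => rw [OTe, OTe]
  simp only [ENNReal.iInf_add, ENNReal.add_iInf]
  exact le_iInf₂ fun π₂ h₂ => le_iInf₂ fun π₁ h₁ => h π₁ h₁ π₂ h₂

lemma OTe_zero_zero (p : ℝ) : OTe p 0 0 = 0 := by
  apply le_antisymm _ zero_le
  refine (iInf₂_le (0 : Measure (Pt × Pt)) ?_).trans ?_
  · simp [Adm]
  · simp [Cost]

lemma OTe_sum (p : ℝ) {ι : Type*} (s : Finset ι) (α β : ι → Measure Pt) :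
    OTe p (∑ i ∈ s, α i) (∑ i ∈ s, β i) ≤ ∑ i ∈ s, OTe p (α i) (β i) := by
  induction s using Finset.induction_on with
  | empty => simp [OTe_zero_zero]
  | insert a s ha ih =>
    rw [Finset.sum_insert ha, Finset.sum_insert ha, Finset.sum_insert ha]
    exact (OTe_add p _ _ _ _).trans (by gcongr)

lemma OTe_le {p : ℝ} {μ ν : Measure Pt} {c : ℝ≥0∞} (π : Measure (Pt × Pt)) (hπ : π ∈ Adm μ ν)
    (hc : Cost p π ≤ c) : OTe p μ ν ≤ c :=
  (iInf₂_le π hπ).trans hc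

lemma OTe_zero_right (p : ℝ) (μ : Measure Pt) (hμ : μ UHPᶜ = 0) : OTe p μ 0 ≤ Pers p μ := by
  have hm : Measurable (fun x : Pt => (x, projD x)) :=
    measurable_id.prodMk cont_projD.measurable
  have hbm : MeasurableSet (UHPbar ×ˢ UHPbar) :=
    isClosed_UHPbar.measurableSet.prod isClosed_UHPbar.measurableSet
  refine OTe_le (μ.map (fun x => (x, projD x))) ⟨?_, ?_, ?_⟩ ?_
  · rw [Measure.map_apply hm hbm.compl]
    refine measure_mono_null ?_ hμ
    intro x hx hxU
    exact hx ⟨Or.inl hxU, Or.inr (projD_mem x)⟩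
  · intro A hA hAU
    rw [Measure.map_apply hm (hA.prod MeasurableSet.univ)]
    congr 1; ext x; simp
  · intro B hB hBU
    rw [Measure.map_apply hm (MeasurableSet.univ.prod hB)]
    have : (fun x : Pt => (x, projD x)) ⁻¹' (univ ×ˢ B) = ∅ := by
      ext x
      simp only [mem_preimage, mem_prod, mem_univ, true_and, mem_empty_iff_false, iff_false]
      exact fun h => Diag_disj (projD_mem x) (hBU h)
    rw [this]; simp
  · have hcm : Measurable (fun z : Pt × Pt => ENNReal.ofReal (dist z.1 z.2 ^ p)) :=
      ((measurable_fst.dist measurable_snd).pow_const p).ennreal_ofReal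
    rw [Cost, lintegral_map hcm hm]
    simp only [dist_projD]
    rw [← wgt_univ p μ hμ, wgt_apply p μ MeasurableSet.univ, Measure.restrict_univ]

lemma OTe_comm_le (p : ℝ) (μ ν : Measure Pt) : OTe p μ ν ≤ OTe p ν μ := by
  refine le_iInf₂ fun π hπ => ?_
  have hcm : Measurable (fun z : Pt × Pt => ENNReal.ofReal (dist z.1 z.2 ^ p)) :=
    ((measurable_fst.dist measurable_snd).pow_const p).ennreal_ofReal
  have hbm : MeasurableSet (UHPbar ×ˢ UHPbar) :=
    isClosed_UHPbar.measurableSet.prod isClosed_UHPbar.measurableSet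
  refine OTe_le (π.map Prod.swap) ⟨?_, ?_, ?_⟩ ?_
  · rw [Measure.map_apply measurable_swap hbm.compl, preimage_compl, preimage_swap_prod]
    exact hπ.1
  · intro A hA hAU
    rw [Measure.map_apply measurable_swap (hA.prod MeasurableSet.univ), preimage_swap_prod]
    exact hπ.2.2 A hA hAU
  · intro A hA hAU
    rw [Measure.map_apply measurable_swap (MeasurableSet.univ.prod hA), preimage_swap_prod]
    exact hπ.2.1 A hA hAU
  · rw [Cost, lintegral_map hcm measurable_swap, Cost]
    simp only [Prod.fst_swap, Prod.snd_swap, dist_comm]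
    exact le_rfl

lemma OTe_zero_left (p : ℝ) (μ : Measure Pt) (hμ : μ UHPᶜ = 0) : OTe p 0 μ ≤ Pers p μ :=
  (OTe_comm_le p 0 μ).trans (OTe_zero_right p μ hμ)

lemma OTe_couple (p : ℝ) (hp : 1 ≤ p) (α β : Measure Pt) [IsFiniteMeasure α] [IsFiniteMeasure β]
    (h : α univ = β univ) (S : Set Pt) (hSU : S ⊆ UHP) (hα : α Sᶜ = 0) (hβ : β Sᶜ = 0)
    (η : ℝ) (hη : ∀ x ∈ S, ∀ y ∈ S, dist x y ≤ η) :
    OTe p α β ≤ ENNReal.ofReal (η ^ p) * α univ := by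
  by_cases h0 : α univ = 0
  · have h1 : α = 0 := Measure.measure_univ_eq_zero.1 h0
    have h2 : β = 0 := Measure.measure_univ_eq_zero.1 (h ▸ h0)
    rw [h1, h2, OTe_zero_zero]; exact zero_le
  have ht : α univ ≠ ⊤ := measure_ne_top _ _
  have hae : ∀ᵐ z ∂((α univ)⁻¹ • α.prod β), z ∈ S ×ˢ S := by
    apply Measure.ae_smul_measure
    have h1 : ∀ᵐ x ∂α, x ∈ S := hα
    have h2 : ∀ᵐ x ∂β, x ∈ S := hβ
    have h3 : ∀ᵐ z ∂(α.prod β), z.1 ∈ S := Measure.quasiMeasurePreserving_fst.ae h1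
    have h4 : ∀ᵐ z ∂(α.prod β), z.2 ∈ S := Measure.quasiMeasurePreserving_snd.ae h2
    filter_upwards [h3, h4] with z h5 h6
    exact ⟨h5, h6⟩
  refine OTe_le ((α univ)⁻¹ • α.prod β) ⟨?_, ?_, ?_⟩ ?_
  · have : ∀ᵐ z ∂((α univ)⁻¹ • α.prod β), z ∈ UHPbar ×ˢ UHPbar := by
      filter_upwards [hae] with z hz
      exact ⟨Or.inl (hSU hz.1), Or.inl (hSU hz.2)⟩
    exact this
  · intro A hA hAU
    rw [Measure.smul_apply, Measure.prod_prod, ← h, smul_eq_mul, mul_comm (α A), ← mul_assoc,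
      ENNReal.inv_mul_cancel h0 ht, one_mul]
  · intro A hA hAU
    rw [Measure.smul_apply, Measure.prod_prod, smul_eq_mul, ← mul_assoc,
      ENNReal.inv_mul_cancel h0 ht, one_mul]
  · rw [Cost]
    calc _ ≤ ∫⁻ _, ENNReal.ofReal (η ^ p) ∂((α univ)⁻¹ • α.prod β) := by
          refine lintegral_mono_ae ?_
          filter_upwards [hae] with z hz
          exact ENNReal.ofReal_le_ofReal
            (Real.rpow_le_rpow dist_nonneg (hη _ hz.1 _ hz.2) (by linarith))
      _ = _ := by
          rw [lintegral_const, Measure.smul_apply, ← univ_prod_univ, Measure.prod_prod, ← h,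
            smul_eq_mul, ← mul_assoc (α univ)⁻¹, ENNReal.inv_mul_cancel h0 ht, one_mul]

lemma Pers_le (p : ℝ) (hp : 1 ≤ p) (α : Measure Pt) (S : Set Pt) (hα : α Sᶜ = 0)
    (D : ℝ) (hD : ∀ x ∈ S, persDist x ≤ D) : Pers p α ≤ ENNReal.ofReal (D ^ p) * α univ := by
  rw [Pers, ← lintegral_const]
  refine (setLIntegral_le_lintegral _ _).trans (lintegral_mono_ae ?_)
  have h1 : ∀ᵐ x ∂α, x ∈ S := hα
  filter_upwards [h1] with x hx
  exact ENNReal.ofReal_le_ofReal (Real.rpow_le_rpow (persDist_nonneg x) (hD x hx) (by linarith))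

lemma OTe_local_aux (p : ℝ) (hp : 1 ≤ p) (α β : Measure Pt) [IsFiniteMeasure α]
    [IsFiniteMeasure β] (hle : α univ ≤ β univ)
    (S : Set Pt) (hSU : S ⊆ UHP) (hα : α Sᶜ = 0) (hβ : β Sᶜ = 0)
    (η : ℝ) (hη : ∀ x ∈ S, ∀ y ∈ S, dist x y ≤ η) (D : ℝ) (hD : ∀ x ∈ S, persDist x ≤ D) :
    OTe p α β ≤ ENNReal.ofReal (η ^ p) * α univ +
      ENNReal.ofReal (D ^ p) * (β univ - α univ) := by
  by_cases h0 : β univ = 0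
  · have h1 : β = 0 := Measure.measure_univ_eq_zero.1 h0
    have h2 : α = 0 := Measure.measure_univ_eq_zero.1 (le_antisymm (h0 ▸ hle) zero_le)
    rw [h1, h2, OTe_zero_zero]; exact zero_le
  have ht : β univ ≠ ⊤ := measure_ne_top _ _
  have hta : α univ ≠ ⊤ := measure_ne_top _ _
  set c : ℝ≥0∞ := α univ / β univ with hc
  set c' : ℝ≥0∞ := (β univ - α univ) / β univ with hc'
  have hcc : c + c' = 1 := by
    rw [hc, hc', ENNReal.div_add_div_same, add_tsub_cancel_of_le hle, ENNReal.div_self h0 ht]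
  have hct : c ≠ ⊤ := ne_top_of_le_ne_top ENNReal.one_ne_top (hcc ▸ le_self_add)
  have hct' : c' ≠ ⊤ := ne_top_of_le_ne_top ENNReal.one_ne_top (hcc ▸ le_add_self)
  have hβs : β = c • β + c' • β := by rw [← add_smul, hcc, one_smul]
  have hf : IsFiniteMeasure (c • β) := Measure.smul_finite β hct
  have e1 : (c • β) univ = α univ := by
    rw [Measure.smul_apply, smul_eq_mul, hc, ENNReal.div_mul_cancel h0 ht]
  have e2 : (c' • β) univ = β univ - α univ := by
    rw [Measure.smul_apply, smul_eq_mul, hc', ENNReal.div_mul_cancel h0 ht]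
  have z1 : (c • β) Sᶜ = 0 := by rw [Measure.smul_apply, hβ, smul_zero]
  have z2 : (c' • β) Sᶜ = 0 := by rw [Measure.smul_apply, hβ, smul_zero]
  have key := OTe_add p α 0 (c • β) (c' • β)
  rw [add_zero, ← hβs] at key
  refine key.trans (add_le_add ?_ ?_)
  · exact OTe_couple p hp α (c • β) e1.symm S hSU hα z1 η hη
  · refine (OTe_zero_left p _ (measure_mono_null (compl_subset_compl.2 hSU) z2)).trans ?_
    rw [← e2]
    exact Pers_le p hp _ S z2 D hD

lemma OTe_local (p : ℝ) (hp : 1 ≤ p) (α β : Measure Pt) [IsFiniteMeasure α]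
    [IsFiniteMeasure β]
    (S : Set Pt) (hSU : S ⊆ UHP) (hα : α Sᶜ = 0) (hβ : β Sᶜ = 0)
    (η : ℝ) (hη : ∀ x ∈ S, ∀ y ∈ S, dist x y ≤ η) (D : ℝ) (hD : ∀ x ∈ S, persDist x ≤ D) :
    OTe p α β ≤ ENNReal.ofReal (η ^ p) * β univ +
      ENNReal.ofReal (D ^ p) * ((β univ - α univ) + (α univ - β univ)) := by
  rcases le_total (α univ) (β univ) with h | h
  · refine (OTe_local_aux p hp α β h S hSU hα hβ η hη D hD).trans ?_
    gcongr
    exact le_self_add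
  · refine ((OTe_comm_le p α β).trans (OTe_local_aux p hp β α h S hSU hβ hα η hη D hD)).trans ?_
    gcongr
    exact le_add_self

lemma exists_partition (K : Set Pt) (hK : IsCompact K) (δ : ℝ) (hδ : 0 < δ) :
    ∃ (t : Finset Pt) (g : Pt → Pt → ℝ), (∀ c ∈ t, c ∈ K) ∧ (∀ c, Continuous (g c)) ∧
      (∀ c x, 0 ≤ g c x) ∧ (∀ c x, g c x ≠ 0 → dist x c ≤ δ) ∧
      (∀ x, ∑ c ∈ t, g c x ≤ 1) ∧ (∀ x ∈ K, ∑ c ∈ t, g c x = 1) := by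
  obtain ⟨t, htK, htf, hcov⟩ := hK.finite_cover_balls (half_pos hδ)
  lift t to Finset Pt using htf
  let f : Pt → Pt → ℝ := fun c x => max 0 (δ - dist x c)
  have hf0 : ∀ c x, 0 ≤ f c x := fun c x => le_max_left _ _
  have hfc : ∀ c, Continuous (f c) := fun c => by
    show Continuous (fun x : Pt => max 0 (δ - dist x c))
    fun_prop
  let S : Pt → ℝ := fun x => ∑ c ∈ t, f c x
  have hSc : Continuous S := continuous_finset_sum _ fun c _ => hfc c
  have hpos : ∀ x, 0 < max (S x) (δ / 2) := fun x => lt_max_of_lt_right (half_pos hδ)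
  refine ⟨t, fun c x => f c x / max (S x) (δ / 2), fun c hc => htK hc, ?_, ?_, ?_, ?_, ?_⟩
  · intro c
    exact (hfc c).div (hSc.max continuous_const) fun x => (hpos x).ne'
  · intro c x
    exact div_nonneg (hf0 c x) (hpos x).le
  · intro c x hx
    by_contra h
    apply hx
    have : f c x = 0 := max_eq_left (by linarith)
    simp [this]
  · intro x
    rw [← Finset.sum_div, div_le_one (hpos x)]
    exact le_max_left _ _
  · intro x hx
    rw [← Finset.sum_div]
    have h1 := hcov hx
    simp only [mem_iUnion, mem_ball, exists_prop] at h1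
    obtain ⟨c, hc, hxc⟩ := h1
    have h2 : δ / 2 ≤ f c x := le_max_of_le_right (by linarith)
    have h3 : f c x ≤ S x := Finset.single_le_sum (f := fun c => f c x) (fun c _ => hf0 c x) hc
    have h4 : max (S x) (δ / 2) = S x := max_eq_left (h2.trans h3)
    rw [h4]
    exact div_self (by linarith)

lemma decomp {ι : Type*} (μ : Measure Pt) (t : Finset ι) (f : ι → Pt → ℝ≥0∞) (f' : Pt → ℝ≥0∞)
    (hf : ∀ i, Measurable (f i)) (h : ∀ x, ∑ i ∈ t, f i x + f' x = 1) :
    μ = ∑ i ∈ t, μ.withDensity (f i) + μ.withDensity f' := by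
  ext A hA
  rw [Measure.add_apply, Measure.finset_sum_apply, withDensity_apply _ hA]
  simp only [withDensity_apply _ hA]
  rw [← lintegral_finset_sum _ (fun i _ => hf i),
    ← lintegral_add_left (Finset.measurable_sum _ fun i _ => hf i)]
  simp [h]

lemma Pers_rest (p : ℝ) (μ : Measure Pt) (K : Set Pt) (hK : IsCompact K)
    (f : Pt → ℝ≥0∞) (hf : Measurable f) (h1 : ∀ x, f x ≤ 1) (h0 : ∀ x ∈ K, f x = 0) :
    Pers p (μ.withDensity f) ≤ wgt p μ (UHP \ K) := by
  have hBm : MeasurableSet (UHP \ K) :=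
    isOpen_UHP.measurableSet.diff hK.isClosed.measurableSet
  have hU := isOpen_UHP.measurableSet
  rw [Pers, wgt_apply p μ hBm, ← lintegral_indicator hU, ← lintegral_indicator hBm,
    lintegral_withDensity_eq_lintegral_mul _ hf ((meas_w p).indicator hU)]
  refine lintegral_mono fun x => ?_
  simp only [Pi.mul_apply]
  by_cases hx : x ∈ UHP \ K
  · rw [indicator_of_mem hx, indicator_of_mem hx.1]
    exact mul_le_of_le_one_left zero_le (h1 x)
  · rw [indicator_of_notMem hx]
    by_cases hxU : x ∈ UHP
    · have : x ∈ K := by by_contra h; exact hx ⟨hxU, h⟩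
      rw [h0 x this, zero_mul]
    · rw [indicator_of_notMem hxU, mul_zero]

lemma limit_exists (p : ℝ) (hp : 1 ≤ p) (μs : ℕ → Measure Pt) (hμs : ∀ n, MemMp p (μs n))
    (C : ℝ≥0∞) (hC : C < ⊤) (hbd : ∀ n, Pers p (μs n) ≤ C)
    (ht : ∀ ε : ℝ, 0 < ε → ∃ K : Set Pt, IsCompact K ∧ K ⊆ UHP ∧
          ∀ n, wgt p (μs n) (UHP \ K) ≤ ENNReal.ofReal ε) :
    ∃ μ, MemMp p μ ∧ ∃ U : Ultrafilter ℕ, (U : Filter ℕ) ≤ atTop ∧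
      ∀ g : Pt → ℝ, Continuous g → (∀ x, 0 ≤ g x) → (∀ x, g x ≤ 1) → ∀ d : ℝ, 0 < d →
        (∀ x, g x ≠ 0 → x ∈ UHP ∧ d ≤ persDist x) →
        Tendsto (fun n => ∫⁻ x, ENNReal.ofReal (g x) ∂(μs n)) U
          (𝓝 (∫⁻ x, ENNReal.ofReal (g x) ∂μ)) := by
  have hp0 : 0 ≤ p := by linarith
  have hfin : ∀ n, IsFiniteMeasure (wgt p (μs n)) := fun n =>
    ⟨by rw [wgt_univ p _ (hμs n).1]; exact (hμs n).2⟩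
  let νs : ℕ → FiniteMeasure Pt := fun n => ⟨wgt p (μs n), hfin n⟩
  choose K hKc hKU hK using fun n : ℕ => ht (1 / ((n : ℝ) + 1)) (by positivity)
  let u : ℕ → NNReal := fun n => Real.toNNReal (1 / ((n : ℝ) + 1))
  have hu : Tendsto u atTop (𝓝 0) := by
    have := (continuous_real_toNNReal.tendsto 0).comp
      (tendsto_one_div_add_atTop_nhds_zero_nat (𝕜 := ℝ))
    simpa [u, Function.comp_def] using this
  have hcomp := isCompact_setOfPred_finiteMeasure_mass_le_compl_isCompact_le
    (E := Pt) (u := u) (K := K) C.toNNReal hu hKc (Or.inl inferInstance)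
  have hmem : ∀ n, νs n ∈ {μ : FiniteMeasure Pt | μ.mass ≤ C.toNNReal ∧ ∀ n, μ (K n)ᶜ ≤ u n} := by
    intro n
    refine ⟨?_, fun m => ?_⟩
    · have : ((νs n).mass : ℝ≥0∞) ≤ (C.toNNReal : ℝ≥0∞) := by
        rw [ENNReal.coe_toNNReal hC.ne, FiniteMeasure.ennreal_mass]
        show wgt p (μs n) univ ≤ C
        rw [wgt_univ p _ (hμs n).1]; exact hbd n
      exact_mod_cast this
    · have : ((νs n (K m)ᶜ : NNReal) : ℝ≥0∞) ≤ (u m : ℝ≥0∞) := by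
        rw [FiniteMeasure.ennreal_coeFn_eq_coeFn_toMeasure]
        show wgt p (μs n) (K m)ᶜ ≤ ENNReal.ofReal _
        refine le_trans ?_ (hK m n)
        calc wgt p (μs n) (K m)ᶜ ≤ wgt p (μs n) (UHP \ K m ∪ UHPᶜ) := by
              apply measure_mono
              intro x hx
              by_cases hxU : x ∈ UHP
              · exact Or.inl ⟨hxU, hx⟩
              · exact Or.inr hxU
          _ ≤ _ := measure_union_le _ _
          _ = _ := by rw [wgt_compl p _ (hμs n).1, add_zero]
      exact_mod_cast this
  obtain ⟨ν, -, hν⟩ := hcomp.ultrafilter_le_nhds' ((hyperfilter ℕ).map νs)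
    (Ultrafilter.mem_map.2 (Filter.univ_mem' hmem))
  have hν' : Tendsto νs (hyperfilter ℕ) (𝓝 ν) := hν
  rw [FiniteMeasure.tendsto_iff_forall_lintegral_tendsto] at hν'
  have hUm := isOpen_UHP.measurableSet
  let wi : Pt → ℝ≥0∞ := fun x => ENNReal.ofReal ((persDist x ^ p)⁻¹)
  have hwi : Measurable wi := (cont_persDist.measurable.pow_const p).inv.ennreal_ofReal
  refine ⟨((ν : Measure Pt).restrict UHP).withDensity wi, ⟨?_, ?_⟩, hyperfilter ℕ,
    Nat.hyperfilter_le_atTop, ?_⟩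
  · apply withDensity_absolutelyContinuous
    rw [Measure.restrict_apply hUm.compl]; simp
  · rw [Pers, ← lintegral_indicator hUm,
      lintegral_withDensity_eq_lintegral_mul _ hwi ((meas_w p).indicator hUm)]
    refine lt_of_le_of_lt (setLIntegral_mono (g := fun _ => 1) measurable_const ?_) ?_
    · intro x hx
      have := Real.rpow_pos_of_pos (persDist_pos hx) p
      simp only [Pi.mul_apply, indicator_of_mem hx, wi]
      rw [← ENNReal.ofReal_mul (by positivity), inv_mul_cancel₀ this.ne', ENNReal.ofReal_one]
    · rw [lintegral_one]; exact measure_lt_top _ _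
  · intro g hg hg0 hg1 d hd hsupp
    let h : Pt → ℝ := fun x => g x / (max (persDist x) d) ^ p
    have hmax : ∀ x, 0 < max (persDist x) d := fun x => lt_max_of_lt_right hd
    have hcont : Continuous h :=
      hg.div ((cont_persDist.max continuous_const).rpow_const fun x => Or.inl (hmax x).ne')
        fun x => (Real.rpow_pos_of_pos (hmax x) p).ne'
    have hdp : 0 < d ^ p := Real.rpow_pos_of_pos hd p
    have hh0 : ∀ x, 0 ≤ h x := fun x => div_nonneg (hg0 x) (Real.rpow_pos_of_pos (hmax x) p).le
    have hhb : ∀ x, h x ≤ 1 / d ^ p := fun x =>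
      div_le_div₀ zero_le_one (hg1 x) hdp (Real.rpow_le_rpow hd.le (le_max_right _ _) hp0)
    let b : BoundedContinuousFunction Pt NNReal :=
      BoundedContinuousFunction.mkOfBound ⟨fun x => Real.toNNReal (h x), continuous_real_toNNReal.comp hcont⟩
        (1 / d ^ p) (by
          intro x y
          rw [NNReal.dist_eq]
          simp only [ContinuousMap.coe_mk, Real.coe_toNNReal _ (hh0 _)]
          rw [abs_le]
          constructor <;> linarith [hh0 x, hh0 y, hhb x, hhb y])
    have hb : ∀ x, (b x : ℝ≥0∞) = ENNReal.ofReal (h x) := fun x => rfl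
    have hbm : Measurable fun x => ENNReal.ofReal (h x) := hcont.measurable.ennreal_ofReal
    have hgm : Measurable fun x => ENNReal.ofReal (g x) := hg.measurable.ennreal_ofReal
    have hlim := hν' b
    simp only [hb] at hlim
    have e1 : ∀ n, ∫⁻ x, ENNReal.ofReal (h x) ∂(νs n : Measure Pt) =
        ∫⁻ x, ENNReal.ofReal (g x) ∂(μs n) := by
      intro n
      show ∫⁻ x, ENNReal.ofReal (h x) ∂(wgt p (μs n)) = _
      rw [wgt, lintegral_withDensity_eq_lintegral_mul _ (meas_w p) hbm]
      refine lintegral_congr fun x => ?_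
      simp only [Pi.mul_apply]
      by_cases hx : g x = 0
      · simp [h, hx]
      · have hx2 := (hsupp x hx)
        have := Real.rpow_pos_of_pos (persDist_pos hx2.1) p
        rw [← ENNReal.ofReal_mul this.le]
        simp only [h, max_eq_left hx2.2]
        rw [mul_div_cancel₀ _ this.ne']
    have e2 : ∫⁻ x, ENNReal.ofReal (h x) ∂(ν : Measure Pt) =
        ∫⁻ x, ENNReal.ofReal (g x) ∂(((ν : Measure Pt).restrict UHP).withDensity wi) := by
      rw [lintegral_withDensity_eq_lintegral_mul _ hwi hgm, ← lintegral_indicator hUm]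
      refine lintegral_congr fun x => ?_
      by_cases hx : g x = 0
      · by_cases hxU : x ∈ UHP
        · simp [h, hx, indicator_of_mem hxU]
        · simp [h, hx, indicator_of_notMem hxU]
      · have hx2 := (hsupp x hx)
        have := Real.rpow_pos_of_pos (persDist_pos hx2.1) p
        rw [indicator_of_mem hx2.1]
        simp only [Pi.mul_apply, wi]
        rw [← ENNReal.ofReal_mul (by positivity)]
        simp only [h, max_eq_left hx2.2]
        rw [div_eq_inv_mul]
    simp only [e1, e2] at hlim
    exact hlim

lemma sum_mass_le (p : ℝ) (hp : 1 ≤ p) (μ : Measure Pt) (L : Set Pt) (hL : MeasurableSet L)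
    (hLU : L ⊆ UHP) (d : ℝ) (hd : 0 < d) (hdL : ∀ x ∈ L, d ≤ persDist x) (G : Pt → ℝ)
    (hG1 : ∀ x, G x ≤ 1) (hG : ∀ x ∉ L, G x = 0) :
    ∫⁻ x, ENNReal.ofReal (G x) ∂μ ≤ ENNReal.ofReal ((d ^ p)⁻¹) * Pers p μ := by
  have hdp : 0 < d ^ p := Real.rpow_pos_of_pos hd p
  rw [Pers, ← lintegral_const_mul _ (meas_w p), ← lintegral_indicator isOpen_UHP.measurableSet]
  refine lintegral_mono fun x => ?_
  by_cases hx : x ∈ L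
  · rw [indicator_of_mem (hLU hx), ← ENNReal.ofReal_mul (by positivity)]
    apply ENNReal.ofReal_le_ofReal
    refine (hG1 x).trans ?_
    rw [inv_mul_eq_div, one_le_div hdp]
    exact Real.rpow_le_rpow hd.le (hdL x hx) (by linarith)
  · simp [hG x hx]

lemma eventually_small (p : ℝ) (hp : 1 ≤ p) (μs : ℕ → Measure Pt) (hμs : ∀ n, MemMp p (μs n))
    (ht : ∀ ε : ℝ, 0 < ε → ∃ K : Set Pt, IsCompact K ∧ K ⊆ UHP ∧
          ∀ n, wgt p (μs n) (UHP \ K) ≤ ENNReal.ofReal ε)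
    (μ : Measure Pt) (hμ : MemMp p μ) (U : Filter ℕ)
    (hlim : ∀ g : Pt → ℝ, Continuous g → (∀ x, 0 ≤ g x) → (∀ x, g x ≤ 1) → ∀ d : ℝ, 0 < d →
        (∀ x, g x ≠ 0 → x ∈ UHP ∧ d ≤ persDist x) →
        Tendsto (fun n => ∫⁻ x, ENNReal.ofReal (g x) ∂(μs n)) U
          (𝓝 (∫⁻ x, ENNReal.ofReal (g x) ∂μ)))
    (ε : ℝ) (hε : 0 < ε) :
    ∀ᶠ n in U, OTe p (μs n) μ ≤ ENNReal.ofReal (4 * ε) := by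
  have hp0 : 0 ≤ p := by linarith
  obtain ⟨K1, hK1c, hK1U, hK1⟩ := ht ε hε
  obtain ⟨K2, hK2c, hK2U, hK2⟩ := inner_reg p μ hμ (ENNReal.ofReal_pos.2 hε).ne'
  set K := K1 ∪ K2 with hKdef
  have hKc : IsCompact K := hK1c.union hK2c
  have hKU : K ⊆ UHP := union_subset hK1U hK2U
  have hKs : ∀ n, wgt p (μs n) (UHP \ K) ≤ ENNReal.ofReal ε := fun n =>
    (measure_mono (sdiff_subset_sdiff_right subset_union_left)).trans (hK1 n)
  have hKμ : wgt p μ (UHP \ K) ≤ ENNReal.ofReal ε :=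
    (measure_mono (sdiff_subset_sdiff_right subset_union_right)).trans hK2.le
  obtain ⟨r, hr, hrU⟩ := hKc.exists_cthickening_subset_open isOpen_UHP hKU
  set L := cthickening r K with hLdef
  have hLc : IsCompact L := hKc.cthickening
  obtain ⟨d, D, hd, hD, hdD⟩ := exists_bounds hLc hrU
  have hdp : 0 < d ^ p := Real.rpow_pos_of_pos hd p
  set M : ℝ := (d ^ p)⁻¹ * (Pers p μ).toReal with hM
  have hM0 : 0 ≤ M := by positivity
  have hMe : ENNReal.ofReal ((d ^ p)⁻¹) * Pers p μ = ENNReal.ofReal M := by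
    rw [hM, ENNReal.ofReal_mul (by positivity), ENNReal.ofReal_toReal hμ.2.ne]
  obtain ⟨δ, hδ, hδr, hδ2, hδM⟩ : ∃ δ : ℝ, 0 < δ ∧ δ ≤ r ∧ 2 * δ ≤ 1 ∧ 2 * δ * M ≤ ε := by
    refine ⟨min r (min (1/2) (ε / (2 * (M + 1)))), by positivity, min_le_left _ _, ?_, ?_⟩
    · have := (min_le_right r (min (1/2) (ε / (2 * (M + 1))))).trans (min_le_left _ _)
      linarith
    · have := (min_le_right r (min (1/2) (ε / (2 * (M + 1))))).trans (min_le_right _ _)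
      calc _ ≤ 2 * (ε / (2 * (M + 1))) * (M + 1) := by gcongr; linarith
        _ = ε := by field_simp
  obtain ⟨t, g, htK, hgc, hg0, hgs, hg1, hgK⟩ := exists_partition K hKc δ hδ
  have hball : ∀ c ∈ t, closedBall c δ ⊆ L := by
    intro c hc x hx
    exact mem_cthickening_of_dist_le x c r K (htK c hc) (le_trans hx hδr)
  have hgle : ∀ c ∈ t, ∀ x, g c x ≤ 1 := fun c hc x =>
    (Finset.single_le_sum (f := fun c => g c x) (fun c _ => hg0 c x) hc).trans (hg1 x)
  have hgL : ∀ c ∈ t, ∀ x, x ∉ L → g c x = 0 := by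
    intro c hc x hx
    by_contra h
    exact hx (hball c hc (hgs c x h))
  let f : Pt → Pt → ℝ≥0∞ := fun c x => ENNReal.ofReal (g c x)
  let f' : Pt → ℝ≥0∞ := fun x => ENNReal.ofReal (1 - ∑ c ∈ t, g c x)
  have hfm : ∀ c, Measurable (f c) := fun c => (hgc c).measurable.ennreal_ofReal
  have hfm' : Measurable f' :=
    (continuous_const.sub (continuous_finset_sum _ fun c _ => hgc c)).measurable.ennreal_ofReal
  have hsum : ∀ x, ∑ c ∈ t, f c x + f' x = 1 := by
    intro x
    show ∑ c ∈ t, ENNReal.ofReal (g c x) + ENNReal.ofReal (1 - ∑ c ∈ t, g c x) = 1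
    rw [← ENNReal.ofReal_sum_of_nonneg (fun c _ => hg0 c x), ← ENNReal.ofReal_add]
    · simp
    · exact Finset.sum_nonneg fun c _ => hg0 c x
    · linarith [hg1 x]
  have hf'1 : ∀ x, f' x ≤ 1 := fun x => hsum x ▸ le_add_self
  have hf'K : ∀ x ∈ K, f' x = 0 := by
    intro x hx
    simp [f', hgK x hx]
  have hmass : ∀ (κ : Measure Pt) c, (κ.withDensity (f c)) univ = ∫⁻ x, f c x ∂κ := by
    intro κ c
    rw [withDensity_apply _ MeasurableSet.univ, Measure.restrict_univ]
  have hfinite : ∀ κ : Measure Pt, MemMp p κ → ∀ c ∈ t, IsFiniteMeasure (κ.withDensity (f c)) := by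
    intro κ hκ c hc
    refine ⟨?_⟩
    rw [hmass]
    refine lt_of_le_of_lt (sum_mass_le p hp κ L hLc.measurableSet hrU d hd
      (fun x hx => (hdD x hx).1) (g c) (hgle c hc) (hgL c hc)) ?_
    exact ENNReal.mul_lt_top ENNReal.ofReal_lt_top hκ.2
  have hsuppS : ∀ (κ : Measure Pt) c, (κ.withDensity (f c)) (closedBall c δ)ᶜ = 0 := by
    intro κ c
    rw [withDensity_apply _ isClosed_closedBall.measurableSet.compl]
    refine (setLIntegral_congr_fun (g := fun _ => 0)
      isClosed_closedBall.measurableSet.compl ?_).trans (by simp)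
    intro x hx
    have : g c x = 0 := by
      by_contra h
      exact hx (hgs c x h)
    simp [f, this]
  have hrest : ∀ κ : Measure Pt, MemMp p κ → (κ.withDensity f') UHPᶜ = 0 := fun κ hκ =>
    withDensity_absolutelyContinuous _ _ hκ.1
  -- the bound
  let E : ℕ → ℝ≥0∞ := fun n => ∑ c ∈ t, ENNReal.ofReal (D ^ p) *
    ((∫⁻ x, f c x ∂μ - ∫⁻ x, f c x ∂(μs n)) + (∫⁻ x, f c x ∂(μs n) - ∫⁻ x, f c x ∂μ))
  have hbound : ∀ n, OTe p (μs n) μ ≤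
      (ENNReal.ofReal ((2 * δ) ^ p) * ∑ c ∈ t, ∫⁻ x, f c x ∂μ + E n) +
        (ENNReal.ofReal ε + ENNReal.ofReal ε) := by
    intro n
    have k1 : OTe p (∑ c ∈ t, (μs n).withDensity (f c) + (μs n).withDensity f')
        (∑ c ∈ t, μ.withDensity (f c) + μ.withDensity f') ≤
        (ENNReal.ofReal ((2 * δ) ^ p) * ∑ c ∈ t, ∫⁻ x, f c x ∂μ + E n) +
        (ENNReal.ofReal ε + ENNReal.ofReal ε) := by
      refine (OTe_add p _ _ _ _).trans (add_le_add ?_ ?_)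
      · refine (OTe_sum p t _ _).trans ?_
        rw [Finset.mul_sum, ← Finset.sum_add_distrib]
        refine Finset.sum_le_sum fun c hc => ?_
        have i1 := hfinite (μs n) (hμs n) c hc
        have i2 := hfinite μ hμ c hc
        have := OTe_local p hp ((μs n).withDensity (f c)) (μ.withDensity (f c)) (closedBall c δ)
          ((hball c hc).trans hrU) (hsuppS _ c) (hsuppS _ c) (2 * δ)
          (fun x hx y hy => by
            have h1 : dist x c ≤ δ := hx
            have h2 : dist y c ≤ δ := hy
            have h3 := dist_triangle_right x y c
            linarith) D (fun x hx => (hdD x (hball c hc hx)).2)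
        rwa [hmass, hmass] at this
      · have := OTe_add p ((μs n).withDensity f') 0 0 (μ.withDensity f')
        rw [add_zero, zero_add] at this
        refine this.trans (add_le_add ?_ ?_)
        · exact ((OTe_zero_right p _ (hrest _ (hμs n))).trans
            (Pers_rest p _ K hKc f' hfm' hf'1 hf'K)).trans (hKs n)
        · exact ((OTe_zero_left p _ (hrest _ hμ)).trans
            (Pers_rest p _ K hKc f' hfm' hf'1 hf'K)).trans hKμ
    rwa [← decomp (μs n) t f f' hfm hsum, ← decomp μ t f f' hfm hsum] at k1
  have hE : Tendsto E U (𝓝 0) := by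
    have h1 : ∀ c ∈ t, Tendsto (fun n => ENNReal.ofReal (D ^ p) *
        ((∫⁻ x, f c x ∂μ - ∫⁻ x, f c x ∂(μs n)) + (∫⁻ x, f c x ∂(μs n) - ∫⁻ x, f c x ∂μ)))
        U (𝓝 0) := by
      intro c hc
      have hl := hlim (g c) (hgc c) (hg0 c) (hgle c hc) d hd (fun x hx => by
        have : x ∈ L := hball c hc (hgs c x hx)
        exact ⟨hrU this, (hdD x this).1⟩)
      have hne : ∫⁻ x, f c x ∂μ ≠ ⊤ := by
        rw [← hmass]
        have := hfinite μ hμ c hc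
        exact measure_ne_top _ _
      have a1 := ENNReal.Tendsto.sub (tendsto_const_nhds (x := ∫⁻ x, f c x ∂μ) (f := U)) hl
        (Or.inl hne)
      have a2 := ENNReal.Tendsto.sub hl (tendsto_const_nhds (x := ∫⁻ x, f c x ∂μ) (f := U))
        (Or.inl hne)
      have a3 := ENNReal.Tendsto.const_mul (a := ENNReal.ofReal (D ^ p)) (a1.add a2)
        (Or.inr ENNReal.ofReal_ne_top)
      simpa [f] using a3
    simpa using tendsto_finset_sum t h1
  have hEs : ∀ᶠ n in U, E n < ENNReal.ofReal ε :=
    hE.eventually (gt_mem_nhds (ENNReal.ofReal_pos.2 hε))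
  have hfirst : ENNReal.ofReal ((2 * δ) ^ p) * ∑ c ∈ t, ∫⁻ x, f c x ∂μ ≤ ENNReal.ofReal ε := by
    have s1 : ∑ c ∈ t, ∫⁻ x, f c x ∂μ ≤ ENNReal.ofReal M := by
      rw [← lintegral_finset_sum _ (fun c _ => hfm c), ← hMe]
      refine le_trans (le_of_eq ?_) (sum_mass_le p hp μ L hLc.measurableSet hrU d hd
        (fun x hx => (hdD x hx).1) (fun x => ∑ c ∈ t, g c x) hg1
        (fun x hx => Finset.sum_eq_zero fun c hc => hgL c hc x hx))
      refine lintegral_congr fun x => ?_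
      exact (ENNReal.ofReal_sum_of_nonneg (fun c _ => hg0 c x)).symm
    have s2 : (2 * δ) ^ p ≤ 2 * δ := by
      simpa using Real.rpow_le_rpow_of_exponent_ge (by positivity : 0 < 2 * δ) hδ2 hp
    calc _ ≤ ENNReal.ofReal (2 * δ) * ENNReal.ofReal M := by gcongr
      _ = ENNReal.ofReal (2 * δ * M) := (ENNReal.ofReal_mul (by positivity)).symm
      _ ≤ _ := ENNReal.ofReal_le_ofReal hδM
  filter_upwards [hEs] with n hn
  refine (hbound n).trans ((add_le_add (add_le_add hfirst hn.le) le_rfl).trans ?_)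
  rw [← ENNReal.ofReal_add hε.le hε.le, ← ENNReal.ofReal_add (by positivity) (by positivity)]
  exact ENNReal.ofReal_le_ofReal (by linarith)

/-- F ⊆ M^p is relatively compact for OT_p iff {μ^p : μ ∈ F} is
tight and sup_{μ∈F} Pers_p(μ) < ∞. -/
theorem stmt10 (p : ℝ) (hp : 1 ≤ p) (F : Set (Measure Pt)) (hF : ∀ μ ∈ F, MemMp p μ) :
    ((∀ μs : ℕ → Measure Pt, (∀ n, μs n ∈ F) →
        ∃ μ, MemMp p μ ∧ ∃ φ : ℕ → ℕ, StrictMono φ ∧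
          Tendsto (fun n => OTe p (μs (φ n)) μ) atTop (𝓝 0)) ↔
      ((∀ ε : ℝ, 0 < ε → ∃ K : Set Pt, IsCompact K ∧ K ⊆ UHP ∧
          ∀ μ ∈ F, wgt p μ (UHP \ K) ≤ ENNReal.ofReal ε) ∧
        (⨆ μ ∈ F, Pers p μ) < ⊤)) := by
  constructor
  · intro H
    exact ⟨tightness p hp F H, boundedness p hp F H⟩
  · rintro ⟨ht, hb⟩ μs hμs
    have hmem : ∀ n, MemMp p (μs n) := fun n => hF _ (hμs n)
    have ht' : ∀ ε : ℝ, 0 < ε → ∃ K : Set Pt, IsCompact K ∧ K ⊆ UHP ∧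
        ∀ n, wgt p (μs n) (UHP \ K) ≤ ENNReal.ofReal ε := by
      intro ε hε
      obtain ⟨K, h1, h2, h3⟩ := ht ε hε
      exact ⟨K, h1, h2, fun n => h3 _ (hμs n)⟩
    obtain ⟨μ, hμ, U, hU, hlim⟩ := limit_exists p hp μs hmem _ hb
      (fun n => le_iSup₂ (f := fun μ (_ : μ ∈ F) => Pers p μ) (μs n) (hμs n)) ht'
    refine ⟨μ, hμ, ?_⟩
    have hfreq : ∀ n : ℕ, ∃ᶠ k in atTop,
        OTe p (μs k) μ ≤ ENNReal.ofReal (4 * (1 / ((n : ℝ) + 1))) := by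
      intro n
      exact ((eventually_small p hp μs hmem ht' μ hμ U hlim (1 / ((n : ℝ) + 1))
        (by positivity)).frequently).filter_mono hU
    obtain ⟨φ, hφ, hφ2⟩ := extraction_forall_of_frequently hfreq
    refine ⟨φ, hφ, ?_⟩
    refine tendsto_of_tendsto_of_tendsto_of_le_of_le tendsto_const_nhds ?_
      (fun _ => zero_le) hφ2
    have h1 := (tendsto_one_div_add_atTop_nhds_zero_nat (𝕜 := ℝ)).const_mul 4
    have h2 := ENNReal.tendsto_ofReal h1
    simpa using h2
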